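/- Fix a slot n and a realization of nonnegative delays, and suppose all attesters in slot n other than attester (i,n) and all proposers follow the equilibrium strategy profile. Then: (a) if proposer n played on-path (t_n = n·Δ + Δ* and the prescribed φ_n), then Ã_n = 1 ≥ γ and χ_n = χ_{n+1} = 1, and attester (i,n)'s payoff is maximized by choosing ν_{(i,n)} = 1 with τ_{(i,n)} = t_n + δ_{n,(i,n)}; any choice with ν_{(i,n)} = 0 yields payoff 0; (b) if proposer n deviated, then Ã_n = 0 < γ and χ_n = 0, and attester (i,n)'s payoff is maximized by choosing ν_{(i,n)} = 0 with τ_{(i,n)} = n·Δ; any choice with ν_{(i,n)} = 1 yields payoff 0. -/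

import Mathlib

/-!
Slot-based proposal game: attester `(i₀, n)`'s best response when all other
attesters and all proposers follow the equilibrium strategy profile.
-/

open MeasureTheory
open scoped Classical

noncomputable section
/-- Successful-attestation measure: Lebesgue measure of the set of attesters
`i ∈ [0,1]` voting for the block. -/
def attMeasure (ν : ℝ → Prop) : ℝ :=
  (volume {i : ℝ | i ∈ Set.Icc (0 : ℝ) 1 ∧ ν i}).toReal

/-- Canonicity indicator of slot `n`: the next proposer builds on block `n`
and block `n` gathers at least measure `γ` of attestations. -/
def chi (γ : ℝ) (φ : ℕ → Prop) (ν : ℕ → ℝ → Prop) (n : ℕ) : Prop :=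
  φ (n + 1) ∧ γ ≤ attMeasure (ν n)

/-- The most recent canonical slot `n_- = max {k ≤ n - 1 : χ_k = 1}`. -/
def lastCanonical (γ : ℝ) (φ : ℕ → Prop) (ν : ℕ → ℝ → Prop) (n : ℕ) : ℕ :=
  sSup {k : ℕ | chi γ φ ν k ∧ k ≤ n - 1}

/-- Proposer `n`'s payoff: `α + μ·(t_n − t_{n_-})⁺` if block `n` is canonical,
`0` otherwise. -/
def proposerPayoff (α μ γ : ℝ) (t : ℕ → ℝ) (φ : ℕ → Prop) (ν : ℕ → ℝ → Prop)
    (n : ℕ) : ℝ :=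
  if chi γ φ ν n then α + μ * max (t n - t (lastCanonical γ φ ν n)) 0 else 0

/-- Attester `(i, n)`'s payoff given their release time `τ` and realized delay
`δout` to proposer `n + 1`: `1` iff the vote is correct (`ν_{(i,n)} = χ_n`),
fresh (`τ + δout ≤ t_{n+1}`) and `χ_{n+1} = 1`, else `0`. -/
def attesterPayoff (γ : ℝ) (t : ℕ → ℝ) (φ : ℕ → Prop) (ν : ℕ → ℝ → Prop)
    (n : ℕ) (i : ℝ) (τ δout : ℝ) : ℝ :=
  if (ν n i ↔ chi γ φ ν n) ∧ τ + δout ≤ t (n + 1) ∧ chi γ φ ν (n + 1) then 1 else 0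

/-- Proposer `n` acted "on path": released at `n·Δ + Δ*` and followed the
φ-rule (build on block `n-1` iff `t_{n-1} ≤ (n-1)·Δ + Δ*`). -/
def onPath (Δ Δstar : ℝ) (t : ℕ → ℝ) (φ : ℕ → Prop) (n : ℕ) : Prop :=
  t n = (n : ℝ) * Δ + Δstar ∧
    (φ n ↔ t (n - 1) ≤ ((n - 1 : ℕ) : ℝ) * Δ + Δstar)

/-- Equilibrium release times: `t_n = n·Δ + Δ*`. -/
def tEq (Δ Δstar : ℝ) (n : ℕ) : ℝ := (n : ℝ) * Δ + Δstar

/-- Equilibrium build decisions: `φ_n = 1` iff `t_{n-1} ≤ (n-1)·Δ + Δ*`. -/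
def phiEq (Δ Δstar : ℝ) (n : ℕ) : Prop :=
  tEq Δ Δstar (n - 1) ≤ ((n - 1 : ℕ) : ℝ) * Δ + Δstar

/-- Equilibrium votes, as a reaction to the realized proposer actions:
attester `(i, n)` votes `1` iff proposer `n` acted on path. -/
def nuEq (Δ Δstar : ℝ) (t : ℕ → ℝ) (φ : ℕ → Prop) (n : ℕ) (_ : ℝ) : Prop :=
  onPath Δ Δstar t φ n

/-- Equilibrium attestation release times: `t_n + δ_{n,(i,n)}` if proposer `n`
acted on path, `n·Δ` otherwise. -/
def tauEq (Δ Δstar : ℝ) (δin : ℕ → ℝ → ℝ) (t : ℕ → ℝ) (φ : ℕ → Prop)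
    (n : ℕ) (i : ℝ) : ℝ :=
  if onPath Δ Δstar t φ n then t n + δin n i else (n : ℝ) * Δ

/-- Realized release times when proposer `n₀` unilaterally deviates to
releasing at time `T` (all other proposers follow the equilibrium). -/
def tDev (Δ Δstar : ℝ) (n₀ : ℕ) (T : ℝ) (n : ℕ) : ℝ :=
  if n = n₀ then T else tEq Δ Δstar n

/-- Realized build decisions when proposer `n₀` unilaterally deviates to
`(T, Φ)`: every other proposer `m` follows the equilibrium φ-rule applied to
the realized release times. -/
def phiDev (Δ Δstar : ℝ) (n₀ : ℕ) (T : ℝ) (Φ : Prop) (n : ℕ) : Prop :=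
  if n = n₀ then Φ
  else tDev Δ Δstar n₀ T (n - 1) ≤ ((n - 1 : ℕ) : ℝ) * Δ + Δstar

theorem attMeasure_of_forall_ne {ν : ℝ → Prop} {i₀ : ℝ} (h : ∀ i, i ≠ i₀ → ν i) :
    attMeasure ν = 1 := by
  have hae : {i : ℝ | i ∈ Set.Icc (0 : ℝ) 1 ∧ ν i} =ᵐ[volume] Set.Icc (0 : ℝ) 1 := by
    filter_upwards [Measure.ae_ne volume i₀] with i hi
    exact propext ⟨fun hx => hx.1, fun hx => ⟨hx, h i hi⟩⟩
  rw [attMeasure, measure_congr hae]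
  simp

theorem attMeasure_of_forall_ne_not {ν : ℝ → Prop} {i₀ : ℝ} (h : ∀ i, i ≠ i₀ → ¬ ν i) :
    attMeasure ν = 0 := by
  have hsub : {i : ℝ | i ∈ Set.Icc (0 : ℝ) 1 ∧ ν i} ⊆ {i₀} := fun i hi => by
    by_contra hne
    exact h i hne hi.2
  rw [attMeasure, measure_mono_null hsub (measure_singleton i₀), ENNReal.toReal_zero]

theorem phiEq_holds (Δ Δstar : ℝ) (n : ℕ) : phiEq Δ Δstar n :=
  le_refl _

theorem onPath_equilibrium (Δ Δstar : ℝ) (n : ℕ) :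
    onPath Δ Δstar (tEq Δ Δstar) (phiEq Δ Δstar) n :=
  ⟨rfl, Iff.rfl⟩

theorem attesterPayoff_mono {γ : ℝ} {t : ℕ → ℝ} {φ : ℕ → Prop} {ν ν' : ℕ → ℝ → Prop} {n : ℕ}
    {i τ τ' δ : ℝ} (hcorrect : (ν n i ↔ chi γ φ ν n) → (ν' n i ↔ chi γ φ ν' n) ∧ τ' ≤ τ)
    (hnext : chi γ φ ν (n + 1) → chi γ φ ν' (n + 1)) :
    attesterPayoff γ t φ ν n i τ δ ≤ attesterPayoff γ t φ ν' n i τ' δ := by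
  unfold attesterPayoff
  by_cases h : (ν n i ↔ chi γ φ ν n) ∧ τ + δ ≤ t (n + 1) ∧ chi γ φ ν (n + 1)
  · have hc := hcorrect h.1
    rw [if_pos h, if_pos ⟨hc.1, by linarith [h.2.1, hc.2], hnext h.2.2⟩]
  · rw [if_neg h]
    split_ifs <;> norm_num

theorem attesterPayoff_eq_zero {γ : ℝ} {t : ℕ → ℝ} {φ : ℕ → Prop} {ν : ℕ → ℝ → Prop} {n : ℕ}
    {i τ δ : ℝ} (h : ¬ (ν n i ↔ chi γ φ ν n)) : attesterPayoff γ t φ ν n i τ δ = 0 :=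
  if_neg fun hc => h hc.1

/-- Attester `(i₀, n)`'s best response, given that all other slot-`n`
attesters and all proposers follow the equilibrium strategy profile.
(a) If proposer `n` played on path (so the realized profile is the
equilibrium one), then `Ã_n = 1 ≥ γ`, `χ_n = χ_{n+1} = 1`, the attester's
payoff is maximized by `ν = 1` with `τ = t_n + δ_{n,(i₀,n)}`, and any choice
with `ν = 0` yields payoff `0`.
(b) If proposer `n` deviated to some feasible `(T, Φ)` off path, then
`Ã_n = 0 < γ`, `χ_n = 0`, the payoff is maximized by `ν = 0` with `τ = n·Δ`,
and any choice with `ν = 1` yields payoff `0`. -/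
theorem attester_best_response
    (Δ Δstar γ α μ : ℝ) (n : ℕ) (i₀ : ℝ) (hi₀ : i₀ ∈ Set.Icc (0 : ℝ) 1)
    (hΔ : 0 < Δ) (hstar : Δstar ∈ Set.Icc (0 : ℝ) Δ)
    (hγ : γ ∈ Set.Ioc (0 : ℝ) 1) (hα : 0 < α) (hμ : 0 < μ)
    (δin δout : ℕ → ℝ → ℝ)
    (hδin : ∀ m j, 0 ≤ δin m j) (hδout : ∀ m j, 0 ≤ δout m j) :
    -- (a) proposer n played on path: the realized profile is the equilibrium
    ((fun (t : ℕ → ℝ) (φ : ℕ → Prop) =>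
      (fun νmod : Prop → ℕ → ℝ → Prop =>
        (∀ v : Prop,
          attMeasure (νmod v n) = 1 ∧ γ ≤ attMeasure (νmod v n) ∧
          chi γ φ (νmod v) n ∧ chi γ φ (νmod v) (n + 1)) ∧
        (∀ (v : Prop) (τ : ℝ), (n : ℝ) * Δ ≤ τ →
          (v → t n + δin n i₀ ≤ τ) →
          attesterPayoff γ t φ (νmod v) n i₀ τ (δout n i₀) ≤
            attesterPayoff γ t φ (νmod True) n i₀ (t n + δin n i₀)
              (δout n i₀)) ∧
        (∀ τ : ℝ, (n : ℝ) * Δ ≤ τ →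
          attesterPayoff γ t φ (νmod False) n i₀ τ (δout n i₀) = 0))
      (fun v m j => if m = n ∧ j = i₀ then v else nuEq Δ Δstar t φ m j))
      (tEq Δ Δstar) (phiEq Δ Δstar)) ∧
    -- (b) proposer n deviated to a feasible off-path action (T, Φ)
    (∀ (T : ℝ) (Φ : Prop), (n : ℝ) * Δ ≤ T →
      ¬ onPath Δ Δstar (tDev Δ Δstar n T) (phiDev Δ Δstar n T Φ) n →
      (fun (t : ℕ → ℝ) (φ : ℕ → Prop) =>
        (fun νmod : Prop → ℕ → ℝ → Prop =>
          (∀ v : Prop,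
            attMeasure (νmod v n) = 0 ∧ 0 < γ ∧ ¬ chi γ φ (νmod v) n) ∧
          (∀ (v : Prop) (τ : ℝ), (n : ℝ) * Δ ≤ τ →
            (v → t n + δin n i₀ ≤ τ) →
            attesterPayoff γ t φ (νmod v) n i₀ τ (δout n i₀) ≤
              attesterPayoff γ t φ (νmod False) n i₀ ((n : ℝ) * Δ)
                (δout n i₀)) ∧
          (∀ τ : ℝ, (n : ℝ) * Δ ≤ τ → t n + δin n i₀ ≤ τ →
            attesterPayoff γ t φ (νmod True) n i₀ τ (δout n i₀) = 0))
        (fun v m j => if m = n ∧ j = i₀ then v else nuEq Δ Δstar t φ m j))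
        (tDev Δ Δstar n T) (phiDev Δ Δstar n T Φ)) := by
  refine ⟨?_, fun T Φ _ hoff => ?_⟩
  · beta_reduce
    set ν : Prop → ℕ → ℝ → Prop := fun v m j =>
      if m = n ∧ j = i₀ then v else nuEq Δ Δstar (tEq Δ Δstar) (phiEq Δ Δstar) m j with hν
    have hvote : ∀ v, ν v n i₀ ↔ v := fun v => by simp [hν]
    have hother : ∀ v m j, j ≠ i₀ → ν v m j := fun v m j h => by
      simp only [hν, h, and_false, if_false]
      exact onPath_equilibrium Δ Δstar m
    have hmeas : ∀ v m, attMeasure (ν v m) = 1 := fun v m =>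
      attMeasure_of_forall_ne (hother v m)
    have hchi : ∀ v m, chi γ (phiEq Δ Δstar) (ν v) m := fun v m =>
      ⟨phiEq_holds Δ Δstar _, (hmeas v m).symm ▸ hγ.2⟩
    refine ⟨fun v => ⟨hmeas v n, (hmeas v n).symm ▸ hγ.2, hchi v n, hchi v (n + 1)⟩,
      fun v τ _ hτ => attesterPayoff_mono (fun h => ?_) (fun _ => hchi _ _),
      fun τ _ => attesterPayoff_eq_zero ?_⟩
    · exact ⟨iff_of_true ((hvote True).2 trivial) (hchi True n),
        hτ ((hvote v).1 (h.2 (hchi v n)))⟩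
    · exact fun h => (hvote False).1 (h.2 (hchi False n))
  · beta_reduce
    set t := tDev Δ Δstar n T
    set φ := phiDev Δ Δstar n T Φ
    set ν : Prop → ℕ → ℝ → Prop := fun v m j =>
      if m = n ∧ j = i₀ then v else nuEq Δ Δstar t φ m j with hν
    have hvote : ∀ v, ν v n i₀ ↔ v := fun v => by simp [hν]
    have hother : ∀ v j, j ≠ i₀ → ¬ ν v n j := fun v j h => by
      simp only [hν, h, and_false, if_false]
      exact hoff
    have hnext : ∀ v, ν v (n + 1) = ν False (n + 1) := fun v => by
      funext j
      simp [hν]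
    have hmeas : ∀ v, attMeasure (ν v n) = 0 := fun v =>
      attMeasure_of_forall_ne_not (hother v)
    have hchi : ∀ v, ¬ chi γ φ (ν v) n := fun v h =>
      absurd (hmeas v ▸ h.2) (not_le.2 hγ.1)
    refine ⟨fun v => ⟨hmeas v, hγ.1, hchi v⟩,
      fun v τ hτ _ => attesterPayoff_mono (fun _ => ?_) (fun h => ?_),
      fun τ _ _ => attesterPayoff_eq_zero ?_⟩
    · exact ⟨iff_of_false (hvote False).1 (hchi False), hτ⟩
    · exact ⟨h.1, h.2.trans_eq (congrArg attMeasure (hnext v))⟩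
    · exact fun h => hchi True (h.1 ((hvote True).2 trivial))
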